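/- Fix an integer r ≥ 1 and let s, B, b_0,…,b_{2r+1}, t_1, g_1, w_1 be as defined; set P := b_1 b_2 ⋯ b_{2r}, and let b′ be the integer satisfying 2·b′ = 1 + P + 2·t_1. Define u′ := P + 2·t_1 (so u′ = 2b′ − 1), m′ := 2·b′·g_1 − 1, and v′ := g_1 + w_1. Then m′·u′ − 1 = (b_0 b_1 ⋯ b_{2r})·b′·v′. (This is identity (7.2) for odd dimension n = 2r+1: in the paper's notation m′_{2r+1} u′_{2r+1} − 1 = b_0⋯b_{2r} b′_{2r+1} v′_{2r+1}; e.g. for r = 1 it reads 493·37 − 1 = 30·19·32.) -/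

import Mathlib

/-- Sylvester's sequence: `s 0 = 2`, `s (j+1) = s j * (s j − 1) + 1`;
it begins 2, 3, 7, 43, 1807, …. -/
def sylv : ℕ → ℕ
  | 0 => 2
  | n + 1 => sylv n * (sylv n - 1) + 1

/-- The alternating sum `B(x₁,…,x_k) = ∑_{j=0}^{k} (−1)^{k−j} x₁⋯x_j`
(the empty product being 1), characterized by `B [] = 1` and
`B (x :: xs) = x * B xs + (−1)^(length (x :: xs))`. -/
def Bsum : List ℤ → ℤ
  | [] => 1
  | x :: xs => x * Bsum xs + (-1) ^ (xs.length + 1)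

/-- `Zl r t` is the list of length `2t` formed by concatenating the pairs
`(b_{r+u}, b_{r+1−u})` for `u = 1, …, t`, where `b` are the exponents
defined inductively together with this list. -/
def Zl (r : ℕ) : ℕ → List ℤ
  | 0 => []
  | t + 1 => Zl r t ++ [1 + ((sylv (r - t) : ℤ) - 1) ^ 2 * Bsum (Zl r t), (sylv (r - t) : ℤ)]

/-- The exponents `b_0, …, b_{2r+1}`: `b_j = s_j` for `j ≤ r`, and
`b_{r+i} = 1 + (b_{r+1−i} − 1)² · B(Z_{i−1})` for `1 ≤ i ≤ r+1`
(here, for `j = r + i`, one has `b_{r+1−i} = s_{2r+1−j}`). -/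
def bexp (r j : ℕ) : ℤ :=
  if j ≤ r then (sylv j : ℤ)
  else 1 + ((sylv (2 * r + 1 - j) : ℤ) - 1) ^ 2 * Bsum (Zl r (j - r - 1))

/-- The list `L_k = (b_{r+1}, b_r, b_{r+2}, b_{r−1}, …, b_{2r+1−k}, b_k)`,
formed by concatenating the pairs `(b_{r+t}, b_{r+1−t})` for `t = 1, …, r+1−k`. -/
def Lk (r k : ℕ) : List ℤ := Zl r (r + 1 - k)

/-- `t_k := B(L_k)`. -/
def tB (r k : ℕ) : ℤ := Bsum (Lk r k)

/-- `g_k := B(reverse of L_k)`. -/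
def gB (r k : ℕ) : ℤ := Bsum (Lk r k).reverse

/-- `T_k`: the alternating sum of `B` over the suffixes of `L_k`
(the full list with sign `+`, the empty suffix contributing `+1`). -/
def TB (r k : ℕ) : ℤ :=
  ∑ m ∈ Finset.range ((Lk r k).length + 1), (-1) ^ m * Bsum ((Lk r k).drop m)

/-- `w_k := (s_k − 1)·T_k − 1`. -/
def wB (r k : ℕ) : ℤ := ((sylv k : ℤ) - 1) * TB r k - 1

theorem one_le_sylv (n : ℕ) : 1 ≤ sylv n := by
  cases n <;> simp [sylv]

theorem sylv_succ_cast (n : ℕ) : (sylv (n + 1) : ℤ) = sylv n * (sylv n - 1) + 1 := by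
  simp [sylv, Nat.cast_sub (one_le_sylv n)]

theorem Bsum_append_singleton (L : List ℤ) (x : ℤ) :
    Bsum (L ++ [x]) = L.prod * x - Bsum L := by
  induction L with
  | nil => simp [Bsum]; ring
  | cons y L ih =>
    simp only [List.cons_append, Bsum, ih, List.length_append, List.length_singleton,
      List.prod_cons]
    ring

theorem Bsum_append_pair (L : List ℤ) (x s : ℤ) :
    Bsum (L ++ [x, s]) = L.prod * x * (s - 1) + Bsum L := by
  have h : L ++ [x, s] = (L ++ [x]) ++ [s] := by simp
  rw [h, Bsum_append_singleton, Bsum_append_singleton]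
  simp
  ring

/-- The alternating sum of `Bsum` over the suffixes of a list. -/
def suffixSum (L : List ℤ) : ℤ :=
  ∑ m ∈ Finset.range (L.length + 1), (-1) ^ m * Bsum (L.drop m)

theorem suffixSum_nil : suffixSum [] = 1 := by simp [suffixSum, Bsum]

theorem suffixSum_cons (y : ℤ) (L : List ℤ) :
    suffixSum (y :: L) = Bsum (y :: L) - suffixSum L := by
  unfold suffixSum
  rw [List.length_cons, Finset.sum_range_succ']
  simp only [List.drop_succ_cons, pow_succ, mul_neg, mul_one, neg_mul, Finset.sum_neg_distrib,
    pow_zero, one_mul, List.drop_zero]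
  ring

theorem suffixSum_append_pair (L : List ℤ) (x s : ℤ) :
    suffixSum (L ++ [x, s]) =
      suffixSum L + x * (s - 1) * Bsum L.reverse + (-1) ^ L.length * (2 - s) := by
  induction L with
  | nil =>
    simp [suffixSum_cons, suffixSum_nil, Bsum]
    ring
  | cons y L ih =>
    rw [List.cons_append, suffixSum_cons, ih, suffixSum_cons, ← List.cons_append,
      Bsum_append_pair, List.reverse_cons, Bsum_append_singleton, List.prod_reverse,
      List.prod_cons, List.length_cons, pow_succ]
    ring

theorem Bsum_reverse_append_pair {L : List ℤ} (hL : Even L.length) (x s : ℤ) :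
    Bsum (L ++ [x, s]).reverse = s * x * Bsum L.reverse - (s - 1) := by
  simp [Bsum, pow_succ, hL.neg_one_pow]
  ring

theorem even_length_Zl (r t : ℕ) : Even (Zl r t).length := by
  induction t with
  | zero => simp [Zl]
  | succ t ih => simpa [Zl, Nat.even_add] using ih

theorem Zl_identity (r t : ℕ) (ht : t ≤ r + 1) :
    ((sylv (r + 1 - t) : ℤ) - 1) *
        (Bsum (Zl r t).reverse * Bsum (Zl r t) - (Zl r t).prod * suffixSum (Zl r t)) =
      1 - (Zl r t).prod := by
  induction t with
  | zero => simp [Zl, Bsum, suffixSum_nil]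
  | succ t ih =>
    have ih := ih (by omega)
    rw [show r + 1 - t = r - t + 1 by omega, sylv_succ_cast] at ih
    rw [show r + 1 - (t + 1) = r - t by omega, Zl,
      Bsum_reverse_append_pair (even_length_Zl r t), Bsum_append_pair, suffixSum_append_pair,
      (even_length_Zl r t).neg_one_pow]
    simp only [List.prod_append, List.prod_cons, List.prod_nil]
    generalize (sylv (r - t) : ℤ) = s at *
    generalize Bsum (Zl r t) = b at *
    linear_combination (1 + (s - 1) ^ 2 * b) * ih

theorem prod_Zl (r t : ℕ) (ht : t ≤ r) :
    (Zl r t).prod = ∏ j ∈ Finset.Ico (r + 1 - t) (r + t + 1), bexp r j := by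
  induction t with
  | zero => simp [Zl]
  | succ t ih =>
    have hs : bexp r (r - t) = (sylv (r - t) : ℤ) := by simp [bexp]
    have hx : bexp r (r + t + 1) = 1 + ((sylv (r - t) : ℤ) - 1) ^ 2 * Bsum (Zl r t) := by
      rw [bexp, if_neg (by omega), show 2 * r + 1 - (r + t + 1) = r - t by omega,
        show r + t + 1 - r - 1 = t by omega]
    rw [Zl, List.prod_append, ih (by omega), show r + 1 - (t + 1) = r - t by omega,
      ← add_assoc,
      Finset.prod_eq_prod_Ico_succ_bot (a := r - t) (by omega),
      Finset.prod_Ico_succ_top (b := r + t + 1) (by omega), hs, hx, show r - t + 1 = r + 1 - t by omega]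
    simp only [List.prod_cons, List.prod_nil]
    ring

/-- Identity (7.2) of Esser–Totaro in odd dimension `n = 2r+1`:
with `P = b_1⋯b_{2r}`, `2b′ = 1 + P + 2t_1`, `u′ = P + 2t_1`, `m′ = 2b′g_1 − 1`
and `v′ = g_1 + w_1`, one has `m′·u′ − 1 = b_0⋯b_{2r}·b′·v′`
(e.g. for `r = 1` it reads `493·37 − 1 = 30·19·32`). -/
theorem large_index_identity_odd (r : ℕ) (hr : 1 ≤ r) (b' : ℤ)
    (hb : 2 * b' = 1 + (∏ j ∈ Finset.Icc 1 (2 * r), bexp r j) + 2 * tB r 1) :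
    (2 * b' * gB r 1 - 1) * ((∏ j ∈ Finset.Icc 1 (2 * r), bexp r j) + 2 * tB r 1) - 1 =
      (∏ j ∈ Finset.Icc 0 (2 * r), bexp r j) * b' * (gB r 1 + wB r 1) := by
  have hP : (∏ j ∈ Finset.Icc 1 (2 * r), bexp r j) = (Zl r r).prod := by
    rw [prod_Zl r r le_rfl, show r + 1 - r = 1 by omega, ← two_mul]
    rfl
  have hP0 : (∏ j ∈ Finset.Icc 0 (2 * r), bexp r j) = 2 * (Zl r r).prod := by
    rw [← hP, ← Finset.mul_prod_Ioc_eq_prod_Icc (Nat.zero_le _)]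
    simp [bexp, sylv]
    rfl
  have key := Zl_identity r r (Nat.le_succ r)
  have hw : wB r 1 = 2 * suffixSum (Zl r r) - 1 := by
    simp [wB, TB, Lk, suffixSum, sylv]
  have ht : tB r 1 = Bsum (Zl r r) := by simp [tB, Lk]
  have hg : gB r 1 = Bsum (Zl r r).reverse := by simp [gB, Lk]
  have h3 : (sylv 1 : ℤ) = 3 := by simp [sylv]
  rw [show r + 1 - r = 1 by omega, h3] at key
  rw [hP, ht] at hb
  rw [hP, hP0, hw, ht, hg]
  generalize Bsum (Zl r r) = b at *
  generalize Bsum (Zl r r).reverse = g at *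
  generalize (Zl r r).prod = p at *
  linear_combination hb + 2 * b' * key
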